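/- Let w ∼ N(0, I_k) be a standard Gaussian vector in ℝ^k, and fix nonzero x, y ∈ ℝ^k with angle θ_0 = ∠(x,y). Then E[1_{w·x>0} 1_{w·y>0} · w wᵀ] = ((π − θ_0)/(2π)) I_k + (sin θ_0 /(2π)) M, where M is the symmetric matrix sending x̂ ↦ ŷ, ŷ ↦ x̂, and vanishing on the orthogonal complement of span{x, y}. -/

import Mathlib

open Real Matrix MeasureTheory ProbabilityTheory

noncomputable def n2 {k : ℕ} (x : Fin k → ℝ) : ℝ := Real.sqrt (x ⬝ᵥ x)

/-- The standard Gaussian measure on `ℝ^k` (i.i.d. `N(0,1)` coordinates). -/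
noncomputable def stdGaussian (k : ℕ) : Measure (Fin k → ℝ) :=
  Measure.pi fun _ => gaussianReal 0 1


lemma gauss2_polar (f : ℝ × ℝ → ℝ) (R g : ℝ → ℝ)
    (h : ∀ r : ℝ, 0 < r → ∀ φ : ℝ, f (r * cos φ, r * sin φ) = R r * g φ) :
    ∫ p, f p ∂((gaussianReal 0 1).prod (gaussianReal 0 1)) =
      (2 * π)⁻¹ * (∫ r in Set.Ioi (0:ℝ), r * exp (-r ^ 2 / 2) * R r) *
        ∫ φ in Set.Ioo (-π) π, g φ := by
  rw [gaussianReal_of_var_ne_zero 0 (one_ne_zero),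
    prod_withDensity (measurable_gaussianPDF 0 1) (measurable_gaussianPDF 0 1),
    integral_withDensity_eq_integral_toReal_smul
      (f := fun z : ℝ × ℝ => gaussianPDF 0 1 z.1 * gaussianPDF 0 1 z.2)
      (((measurable_gaussianPDF 0 1).comp measurable_fst).mul
        ((measurable_gaussianPDF 0 1).comp measurable_snd))
      (Filter.Eventually.of_forall fun p => ENNReal.mul_lt_top gaussianPDF_lt_top gaussianPDF_lt_top)]
  rw [← Measure.volume_eq_prod, ← integral_comp_polarCoord_symm, polarCoord_target]
  rw [mul_assoc, ← setIntegral_prod_mul, ← integral_const_mul]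
  refine setIntegral_congr_fun (measurableSet_Ioi.prod measurableSet_Ioo) ?_
  rintro ⟨r, φ⟩ ⟨hr, hφ⟩
  simp only [Set.mem_Ioi] at hr
  simp only [polarCoord_symm_apply, ENNReal.toReal_mul, toReal_gaussianPDF, smul_eq_mul, h r hr φ]
  simp only [gaussianPDFReal, NNReal.coe_one, mul_one, sub_zero]
  have h1 : exp (-(r * cos φ) ^ 2 / 2) * exp (-(r * sin φ) ^ 2 / 2) = exp (-r ^ 2 / 2) := by
    rw [← Real.exp_add]; congr 1
    have := Real.sin_sq_add_cos_sq φ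
    linear_combination (-r^2/2) * this
  have h2 : (√(2 * π))⁻¹ * (√(2 * π))⁻¹ = (2 * π)⁻¹ := by
    rw [← mul_inv, Real.mul_self_sqrt (by positivity)]
  rw [← h1, ← h2]; ring

lemma radial1 : ∫ r in Set.Ioi (0:ℝ), r * exp (-r ^ 2 / 2) * 1 = 1 := by
  have := integral_rpow_mul_exp_neg_mul_rpow (p := 2) (q := 1) (b := 1/2)
    (by norm_num) (by norm_num) (by norm_num)
  norm_num at this
  refine Eq.trans ?_ this
  refine setIntegral_congr_fun measurableSet_Ioi fun r hr => ?_
  simp only [mul_one]; congr 2; ring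

lemma radial2 : ∫ r in Set.Ioi (0:ℝ), r * exp (-r ^ 2 / 2) * r ^ 2 = 2 := by
  have := integral_rpow_mul_exp_neg_mul_rpow (p := 2) (q := 3) (b := 1/2)
    (by norm_num) (by norm_num) (by norm_num)
  norm_num at this
  refine Eq.trans ?_ this
  refine setIntegral_congr_fun measurableSet_Ioi fun r hr => ?_
  have : exp (-r ^ 2 / 2) = exp (-(1 / 2 * r ^ 2)) := by congr 1; ring
  simp only [this]
  norm_cast
  ring

/-- indicator of the cone -/
noncomputable def coneI (θ s t : ℝ) : ℝ :=
  (if 0 < s then (1 : ℝ) else 0) * (if 0 < cos θ * s + sin θ * t then (1 : ℝ) else 0)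

lemma coneI_polar (θ r φ : ℝ) (hr : 0 < r) :
    coneI θ (r * cos φ) (r * sin φ) =
      (if 0 < cos φ ∧ 0 < cos (φ - θ) then (1:ℝ) else 0) := by
  have h : cos θ * (r * cos φ) + sin θ * (r * sin φ) = r * cos (φ - θ) := by
    rw [Real.cos_sub]; ring
  rw [coneI, h]
  simp only [mul_pos_iff_of_pos_left hr]
  split_ifs <;> simp_all

lemma cone_iff (θ φ : ℝ) (h0 : 0 < θ) (h1 : θ < π) (hφ : φ ∈ Set.Ioo (-π) π) :
    (0 < cos φ ∧ 0 < cos (φ - θ)) ↔ φ ∈ Set.Ioo (θ - π / 2) (π / 2) := by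
  obtain ⟨ha, hb⟩ := hφ
  constructor
  · rintro ⟨hc, hd⟩
    have e1 : φ < π / 2 := by
      by_contra! hh
      have := cos_nonpos_of_pi_div_two_le_of_le hh (by linarith)
      linarith
    have e2 : -(π / 2) < φ := by
      by_contra! hh
      have := cos_nonpos_of_pi_div_two_le_of_le (x := -φ) (by linarith) (by linarith)
      rw [Real.cos_neg] at this; linarith
    refine ⟨?_, e1⟩
    by_contra! hh
    have := cos_nonpos_of_pi_div_two_le_of_le (x := -(φ - θ)) (by linarith) (by linarith)
    rw [Real.cos_neg] at this; linarith
  · rintro ⟨hc, hd⟩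
    exact ⟨cos_pos_of_mem_Ioo ⟨by linarith, hd⟩, cos_pos_of_mem_Ioo ⟨by linarith, by linarith⟩⟩

lemma cone_angular (θ : ℝ) (h0 : 0 < θ) (h1 : θ < π) (g : ℝ → ℝ) :
    ∫ φ in Set.Ioo (-π) π, (if 0 < cos φ ∧ 0 < cos (φ - θ) then (1:ℝ) else 0) * g φ =
      ∫ φ in (θ - π / 2)..(π / 2), g φ := by
  rw [intervalIntegral.integral_of_le (by linarith), integral_Ioc_eq_integral_Ioo]
  have : Set.Ioo (θ - π / 2) (π / 2) = Set.Ioo (-π) π ∩ Set.Ioo (θ - π / 2) (π / 2) := by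
    rw [Set.inter_eq_right.2]
    exact Set.Ioo_subset_Ioo (by linarith [pi_pos]) (by linarith [pi_pos])
  rw [this, ← setIntegral_indicator measurableSet_Ioo]
  refine setIntegral_congr_fun measurableSet_Ioo fun φ hφ => ?_
  simp only [cone_iff θ φ h0 h1 hφ, Set.indicator_apply]
  split_ifs <;> simp

lemma cone_gen0 (θ : ℝ) (h0 : 0 < θ) (h1 : θ < π) :
    ∫ p, coneI θ p.1 p.2 ∂((gaussianReal 0 1).prod (gaussianReal 0 1)) =
      (π - θ) / (2 * π) := by
  rw [gauss2_polar _ (fun _ => 1)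
    (fun φ => (if 0 < cos φ ∧ 0 < cos (φ - θ) then (1:ℝ) else 0) * 1), radial1,
    cone_angular θ h0 h1]
  · simp; ring
  · intro r hr φ
    simp only [coneI_polar θ r φ hr]; ring

lemma cone_gen2 (θ : ℝ) (h0 : 0 < θ) (h1 : θ < π) (q : ℝ → ℝ → ℝ)
    (hq : ∀ r φ, q (r * cos φ) (r * sin φ) = r ^ 2 * q (cos φ) (sin φ)) :
    ∫ p, coneI θ p.1 p.2 * q p.1 p.2 ∂((gaussianReal 0 1).prod (gaussianReal 0 1)) =
      π⁻¹ * ∫ φ in (θ - π / 2)..(π / 2), q (cos φ) (sin φ) := by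
  rw [gauss2_polar _ (fun r => r ^ 2)
    (fun φ => (if 0 < cos φ ∧ 0 < cos (φ - θ) then (1:ℝ) else 0) * q (cos φ) (sin φ)), radial2,
    cone_angular θ h0 h1]
  · simp
  · intro r hr φ
    simp only [coneI_polar θ r φ hr, hq]; ring

lemma cone_ss (θ : ℝ) (h0 : 0 < θ) (h1 : θ < π) :
    ∫ p, coneI θ p.1 p.2 * (p.1 * p.1) ∂((gaussianReal 0 1).prod (gaussianReal 0 1)) =
      (π - θ) / (2 * π) + sin θ / (2 * π) * cos θ := by
  rw [cone_gen2 θ h0 h1 (fun s t => s * s) (by intros; ring)]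
  simp only [← pow_two, integral_cos_sq]
  rw [Real.cos_sub_pi_div_two, Real.sin_sub_pi_div_two, Real.cos_pi_div_two]
  field_simp; ring

lemma cone_tt (θ : ℝ) (h0 : 0 < θ) (h1 : θ < π) :
    ∫ p, coneI θ p.1 p.2 * (p.2 * p.2) ∂((gaussianReal 0 1).prod (gaussianReal 0 1)) =
      (π - θ) / (2 * π) - sin θ / (2 * π) * cos θ := by
  rw [cone_gen2 θ h0 h1 (fun s t => t * t) (by intros; ring)]
  simp only [← pow_two, integral_sin_sq]
  rw [Real.cos_sub_pi_div_two, Real.sin_sub_pi_div_two, Real.cos_pi_div_two]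
  field_simp; ring

lemma cone_st (θ : ℝ) (h0 : 0 < θ) (h1 : θ < π) :
    ∫ p, coneI θ p.1 p.2 * (p.1 * p.2) ∂((gaussianReal 0 1).prod (gaussianReal 0 1)) =
      sin θ / (2 * π) * sin θ := by
  rw [cone_gen2 θ h0 h1 (fun s t => s * t) (by intros; ring)]
  have : ∀ φ, cos φ * sin φ = sin φ * cos φ := fun φ => mul_comm _ _
  simp only [this, integral_sin_mul_cos₁]
  rw [Real.sin_sub_pi_div_two, Real.sin_pi_div_two]
  have := Real.sin_sq_add_cos_sq θ
  field_simp
  linear_combination -this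

instance (k : ℕ) : IsProbabilityMeasure (stdGaussian k) := by
  unfold _root_.stdGaussian; infer_instance

/-- change of coordinates attached to an orthonormal basis -/
noncomputable def rotT {k : ℕ} (b : OrthonormalBasis (Fin k) ℝ (EuclideanSpace ℝ (Fin k)))
    (s : Fin k → ℝ) : Fin k → ℝ := fun i => ∑ p, s p * b p i

lemma measurable_rotT {k : ℕ} (b : OrthonormalBasis (Fin k) ℝ (EuclideanSpace ℝ (Fin k))) :
    Measurable (rotT b) := by
  unfold rotT; fun_prop

lemma map_rotT {k : ℕ} (b : OrthonormalBasis (Fin k) ℝ (EuclideanSpace ℝ (Fin k))) :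
    (stdGaussian k).map (rotT b) = stdGaussian k := by
  have h1 := stdGaussian_eq_map_pi_orthonormalBasis b
  rw [← map_pi_eq_stdGaussian] at h1
  have h2 := congrArg (Measure.map (WithLp.ofLp (p := 2) (V := Fin k → ℝ))) h1
  rw [Measure.map_map (by fun_prop) (by fun_prop), Measure.map_map (by fun_prop) (by fun_prop)] at h2
  have e1 : (WithLp.ofLp (p := 2) (V := Fin k → ℝ)) ∘ (WithLp.toLp 2) = id := rfl
  have e2 : (WithLp.ofLp (p := 2) (V := Fin k → ℝ)) ∘ (fun x : Fin k → ℝ => ∑ i, x i • b i)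
      = rotT b := by
    ext s i
    simp [rotT]
  rw [e1, e2, Measure.map_id] at h2
  exact h2.symm

lemma rot_integral {k : ℕ} (b : OrthonormalBasis (Fin k) ℝ (EuclideanSpace ℝ (Fin k)))
    (F : (Fin k → ℝ) → ℝ) (hF : Measurable F) :
    ∫ w, F w ∂(stdGaussian k) = ∫ s, F (rotT b s) ∂(stdGaussian k) := by
  conv_lhs => rw [← map_rotT b]
  rw [integral_map (measurable_rotT b).aemeasurable hF.aestronglyMeasurable]

lemma rotT_dot {k : ℕ} (b : OrthonormalBasis (Fin k) ℝ (EuclideanSpace ℝ (Fin k)))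
    (s : Fin k → ℝ) (a : Fin k) : rotT b s ⬝ᵥ (b a).ofLp = s a := by
  have h : ∀ p, ∑ i, b p i * b a i = if p = a then 1 else 0 := by
    intro p
    have := b.inner_eq_ite p a
    rw [← this]
    simp [PiLp.inner_apply, mul_comm]
  simp only [dotProduct, rotT, Finset.sum_mul]
  rw [Finset.sum_comm]
  simp only [mul_assoc, ← Finset.mul_sum, h]
  simp

lemma basis_complete {k : ℕ} (b : OrthonormalBasis (Fin k) ℝ (EuclideanSpace ℝ (Fin k)))
    (i j : Fin k) : ∑ p, b p i * b p j = (1 : Matrix (Fin k) (Fin k) ℝ) i j := by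
  have := b.sum_inner_mul_inner (EuclideanSpace.single i (1:ℝ)) (EuclideanSpace.single j (1:ℝ))
  simp [EuclideanSpace.inner_single_left, EuclideanSpace.inner_single_right] at this
  rw [this, Matrix.one_apply]
  simp [eq_comm]

lemma memLp_coord {k : ℕ} (p : Fin k) : MemLp (fun s : Fin k → ℝ => s p) 2 (stdGaussian k) :=
  (memLp_id_gaussianReal (μ := 0) (v := 1) 2).comp_measurePreserving
    (measurePreserving_eval (fun _ : Fin k => gaussianReal 0 1) p)

lemma integrable_coord {k : ℕ} (p q : Fin k) :
    Integrable (fun s : Fin k → ℝ => s p * s q) (stdGaussian k) :=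
  (memLp_coord p).integrable_mul (memLp_coord q)

lemma measurable_coneI (θ : ℝ) : Measurable (fun p : ℝ × ℝ => coneI θ p.1 p.2) := by
  unfold coneI
  refine Measurable.mul ?_ ?_
  · exact Measurable.ite (measurableSet_lt (by fun_prop) (by fun_prop)) (by fun_prop) (by fun_prop)
  · exact Measurable.ite (measurableSet_lt (by fun_prop) (by fun_prop)) (by fun_prop) (by fun_prop)

lemma measurable_coneI' {k : ℕ} (θ : ℝ) (a c : Fin k) :
    Measurable (fun s : Fin k → ℝ => coneI θ (s a) (s c)) :=
  (measurable_coneI θ).comp (by fun_prop : Measurable fun s : Fin k → ℝ => (s a, s c))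

lemma coneI_bdd (θ s t : ℝ) : ‖coneI θ s t‖ ≤ 1 := by
  unfold coneI
  split_ifs <;> simp

lemma integrable_cone {k : ℕ} (θ : ℝ) (a c p q : Fin k) :
    Integrable (fun s : Fin k → ℝ => coneI θ (s a) (s c) * (s p * s q)) (stdGaussian k) :=
  (integrable_coord p q).bdd_mul (c := 1) (measurable_coneI' θ a c).aestronglyMeasurable
    (Filter.Eventually.of_forall fun _ => coneI_bdd _ _ _)

lemma iIndep_coord (k : ℕ) : iIndepFun (fun (i : Fin k) (s : Fin k → ℝ) => s i) (stdGaussian k) :=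
  iIndepFun_pi (X := fun _ x => x) (fun _ => by fun_prop)

lemma map_coord {k : ℕ} (p : Fin k) :
    (stdGaussian k).map (fun s => s p) = gaussianReal 0 1 :=
  (measurePreserving_eval (fun _ : Fin k => gaussianReal 0 1) p).map_eq

lemma map_pair {k : ℕ} (a c : Fin k) (h : a ≠ c) :
    (stdGaussian k).map (fun s => (s a, s c)) = (gaussianReal 0 1).prod (gaussianReal 0 1) := by
  have := (iIndep_coord k).indepFun h
  rw [indepFun_iff_map_prod_eq_prod_map_map
    (measurable_pi_apply a).aemeasurable (measurable_pi_apply c).aemeasurable] at this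
  rw [this, map_coord, map_coord]

lemma integral_gpair {k : ℕ} (a c : Fin k) (h : a ≠ c) (f : ℝ × ℝ → ℝ) (hf : Measurable f) :
    ∫ s, f (s a, s c) ∂(stdGaussian k) =
      ∫ p, f p ∂((gaussianReal 0 1).prod (gaussianReal 0 1)) := by
  rw [← map_pair a c h, integral_map (Measurable.aemeasurable (by fun_prop)) hf.aestronglyMeasurable]

lemma integral_sq_coord {k : ℕ} (p : Fin k) : ∫ s, s p * s p ∂(stdGaussian k) = 1 := by
  have h : ∫ x, x * x ∂(gaussianReal 0 1) = 1 := by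
    have h1 := variance_fun_id_gaussianReal (μ := 0) (v := 1)
    rw [variance_of_integral_eq_zero (by fun_prop) (by simp)] at h1
    simpa [pow_two] using h1
  rw [← h, ← map_coord p,
    integral_map (measurable_pi_apply p).aemeasurable (by fun_prop)]

/-- reflection in one coordinate -/
lemma flip_preserving {k : ℕ} (p : Fin k) :
    MeasurePreserving (fun (s : Fin k → ℝ) i => if i = p then - s i else s i)
      (stdGaussian k) (stdGaussian k) := by
  have := measurePreserving_pi (fun _ : Fin k => gaussianReal 0 1) (fun _ => gaussianReal 0 1)
    (f := fun i x => if i = p then -x else x) ?_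
  · exact this
  · intro i
    by_cases h : i = p
    · simp only [h, if_true]
      exact ⟨measurable_neg, by
        have := gaussianReal_map_neg (μ := 0) (v := 1)
        simpa using this⟩
    · simp only [h, if_false]
      exact MeasurePreserving.id _

lemma cone_off {k : ℕ} (θ : ℝ) (a c p q : Fin k) (hpa : p ≠ a) (hpc : p ≠ c) (hpq : p ≠ q) :
    ∫ s, coneI θ (s a) (s c) * (s p * s q) ∂(stdGaussian k) = 0 := by
  have hm : Measurable fun s : Fin k → ℝ => coneI θ (s a) (s c) * (s p * s q) :=
    (measurable_coneI' θ a c).mul (by fun_prop)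
  have h := integral_map (μ := stdGaussian k) (flip_preserving p).measurable.aemeasurable
    hm.aestronglyMeasurable
  rw [(flip_preserving p).map_eq] at h
  simp only [hpa.symm, hpc.symm, hpq.symm, if_true, if_false, neg_mul, mul_neg,
    integral_neg] at h
  linarith

lemma cone_indep {k : ℕ} (θ : ℝ) (h0 : 0 < θ) (h1 : θ < π)
    (a c p : Fin k) (hac : a ≠ c) (hpa : p ≠ a) (hpc : p ≠ c) :
    ∫ s, coneI θ (s a) (s c) * (s p * s p) ∂(stdGaussian k) = (π - θ) / (2 * π) := by
  have hi := (iIndep_coord k).indepFun_prodMk (fun i => by fun_prop) a c p hpa.symm hpc.symm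
  have hi2 := hi.comp (measurable_coneI θ) (by fun_prop : Measurable fun x : ℝ => x * x)
  have := hi2.integral_fun_mul_eq_mul_integral
    (measurable_coneI' θ a c).aestronglyMeasurable
    (Measurable.aestronglyMeasurable (by fun_prop))
  simp only [Function.comp_def] at this
  rw [this, integral_sq_coord, mul_one,
    integral_gpair a c hac (fun p => coneI θ p.1 p.2) (measurable_coneI θ), cone_gen0 θ h0 h1]

/-- the entries of the matrix `M` in the adapted basis -/
noncomputable def mcoef {k : ℕ} (θ : ℝ) (a c p q : Fin k) : ℝ :=
  cos θ * ((if p = a then 1 else 0) * (if q = a then 1 else 0)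
      - (if p = c then 1 else 0) * (if q = c then 1 else 0))
    + sin θ * ((if p = a then 1 else 0) * (if q = c then 1 else 0)
      + (if p = c then 1 else 0) * (if q = a then 1 else 0))

lemma cone_coord {k : ℕ} (θ : ℝ) (h0 : 0 < θ) (h1 : θ < π) (a c p q : Fin k) (hac : a ≠ c) :
    ∫ s, coneI θ (s a) (s c) * (s p * s q) ∂(stdGaussian k) =
      (π - θ) / (2 * π) * (if p = q then 1 else 0) + sin θ / (2 * π) * mcoef θ a c p q := by
  have hm := measurable_coneI θ
  by_cases hp : p ≠ a ∧ p ≠ c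
  · by_cases hpq : p = q
    · subst hpq
      rw [cone_indep θ h0 h1 a c p hac hp.1 hp.2]
      simp [mcoef, hp.1, hp.2]
    · rw [cone_off θ a c p q hp.1 hp.2 hpq]
      simp [mcoef, hp.1, hp.2, hpq]
  by_cases hq : q ≠ a ∧ q ≠ c
  · have hpq : q ≠ p := by rintro rfl; exact hp hq
    have := cone_off θ a c q p hq.1 hq.2 hpq
    have e : ∀ s : Fin k → ℝ, s p * s q = s q * s p := fun s => mul_comm _ _
    simp only [e, this]
    simp [mcoef, hq.1, hq.2, hpq.symm]
  have hss := integral_gpair a c hac (fun p => coneI θ p.1 p.2 * (p.1 * p.1)) (hm.mul (by fun_prop))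
  have htt := integral_gpair a c hac (fun p => coneI θ p.1 p.2 * (p.2 * p.2)) (hm.mul (by fun_prop))
  have hst := integral_gpair a c hac (fun p => coneI θ p.1 p.2 * (p.1 * p.2)) (hm.mul (by fun_prop))
  rw [cone_ss θ h0 h1] at hss
  rw [cone_tt θ h0 h1] at htt
  rw [cone_st θ h0 h1] at hst
  have hp' : p = a ∨ p = c := by tauto
  have hq' : q = a ∨ q = c := by tauto
  rcases hp' with rfl | rfl <;> rcases hq' with rfl | rfl
  · simp only [hss, mcoef, hac]; simp
  · simp only [hst, mcoef, hac, hac.symm]; simp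
  · have e : ∀ s : Fin k → ℝ, s p * s q = s q * s p := fun s => mul_comm _ _
    simp only [e, hst, mcoef, hac, hac.symm]; simp
  · simp only [htt, mcoef, hac.symm]; simp; ring

lemma inner_toLp {k : ℕ} (u v : Fin k → ℝ) :
    inner ℝ (WithLp.toLp 2 u : EuclideanSpace ℝ (Fin k)) (WithLp.toLp 2 v) = u ⬝ᵥ v := by
  simp [PiLp.inner_apply, dotProduct, mul_comm]

lemma norm_toLp_one {k : ℕ} (u : Fin k → ℝ) (hu : u ⬝ᵥ u = 1) :
    ‖(WithLp.toLp 2 u : EuclideanSpace ℝ (Fin k))‖ = 1 := by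
  have h := real_inner_self_eq_norm_sq (WithLp.toLp 2 u : EuclideanSpace ℝ (Fin k))
  rw [inner_toLp, hu] at h
  exact (pow_eq_one_iff_of_nonneg (norm_nonneg _) two_ne_zero).1 h.symm

lemma exists_basis2 {k : ℕ} (u e : Fin k → ℝ) (huu : u ⬝ᵥ u = 1) (hee : e ⬝ᵥ e = 1)
    (hue : u ⬝ᵥ e = 0) :
    ∃ (b : OrthonormalBasis (Fin k) ℝ (EuclideanSpace ℝ (Fin k))) (a c : Fin k),
      a ≠ c ∧ (b a).ofLp = u ∧ (b c).ofLp = e := by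
  have heu : e ⬝ᵥ u = 0 := by rw [dotProduct_comm, hue]
  have hk : 2 ≤ k := by
    have ho : Orthonormal ℝ ![(WithLp.toLp 2 u : EuclideanSpace ℝ (Fin k)), WithLp.toLp 2 e] := by
      rw [orthonormal_iff_ite]
      intro i j
      fin_cases i <;> fin_cases j <;> 
        simp [inner_toLp, norm_toLp_one, huu, hee, hue, heu]
    simpa using ho.linearIndependent.fintype_card_le_finrank
  let a : Fin k := ⟨0, by omega⟩
  let c : Fin k := ⟨1, by omega⟩
  have hac : a ≠ c := by simp [a, c]
  let v : Fin k → EuclideanSpace ℝ (Fin k) :=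
    fun i => if i = a then WithLp.toLp 2 u else WithLp.toLp 2 e
  have hv : Orthonormal ℝ (({a, c} : Set (Fin k)).domRestrict v) := by
    rw [orthonormal_iff_ite]
    rintro ⟨i, hi⟩ ⟨j, hj⟩
    rcases hi with rfl | rfl <;> rcases hj with rfl | rfl <;>
      simp [v, inner_toLp, norm_toLp_one, huu, hee, hue, heu, hac, hac.symm, Subtype.ext_iff]
  obtain ⟨b, hb⟩ := hv.exists_orthonormalBasis_extension_of_card_eq (by simp)
  refine ⟨b, a, c, hac, ?_, ?_⟩
  · rw [hb a (by simp)]; simp [v]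
  · rw [hb c (by simp)]; simp [v, hac.symm]

lemma exists_basis1 {k : ℕ} (u : Fin k → ℝ) (huu : u ⬝ᵥ u = 1) :
    ∃ (b : OrthonormalBasis (Fin k) ℝ (EuclideanSpace ℝ (Fin k))) (a : Fin k),
      (b a).ofLp = u := by
  have hk : 0 < k := by
    rcases Nat.eq_zero_or_pos k with rfl | h
    · simp [dotProduct] at huu
    · exact h
  let a : Fin k := ⟨0, hk⟩
  have hv : Orthonormal ℝ (({a} : Set (Fin k)).domRestrict
      (fun _ => (WithLp.toLp 2 u : EuclideanSpace ℝ (Fin k)))) := by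
    rw [orthonormal_iff_ite]
    rintro ⟨i, hi⟩ ⟨j, hj⟩
    rcases hi with rfl
    rcases hj with rfl
    simp [norm_toLp_one, huu]
  obtain ⟨b, hb⟩ := hv.exists_orthonormalBasis_extension_of_card_eq (by simp)
  exact ⟨b, a, by rw [hb a (by simp)]⟩

/-- the matrix `M` in terms of the orthonormal frame `u, e` -/
noncomputable def Mmat {k : ℕ} (C S : ℝ) (u e : Fin k → ℝ) : Matrix (Fin k) (Fin k) ℝ :=
  Matrix.of fun i j => C * (u i * u j - e i * e j) + S * (u i * e j + e i * u j)

lemma Mmat_mulVec {k : ℕ} (C S : ℝ) (u e z : Fin k → ℝ) :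
    (Mmat C S u e).mulVec z =
      (C * (u ⬝ᵥ z) + S * (e ⬝ᵥ z)) • u + (S * (u ⬝ᵥ z) - C * (e ⬝ᵥ z)) • e := by
  ext i
  simp only [Matrix.mulVec, Mmat, dotProduct, Matrix.of_apply, Pi.add_apply, Pi.smul_apply,
    smul_eq_mul, Finset.mul_sum, add_mul, sub_mul, Finset.sum_mul, ← Finset.sum_add_distrib,
    ← Finset.sum_sub_distrib]
  exact Finset.sum_congr rfl fun j _ => by ring

lemma measurable_ind {k : ℕ} (u : Fin k → ℝ) :
    Measurable (fun w : Fin k → ℝ => if 0 < w ⬝ᵥ u then (1:ℝ) else 0) := by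
  refine Measurable.ite (measurableSet_lt (by fun_prop) ?_) (by fun_prop) (by fun_prop)
  unfold dotProduct; fun_prop

lemma generic_integral {k : ℕ} (θ : ℝ) (h0 : 0 < θ) (h1 : θ < π) (u e v : Fin k → ℝ)
    (huu : u ⬝ᵥ u = 1) (hee : e ⬝ᵥ e = 1) (hue : u ⬝ᵥ e = 0) (hv : v = cos θ • u + sin θ • e)
    (i j : Fin k) :
    ∫ w : Fin k → ℝ, (if 0 < w ⬝ᵥ u then (1 : ℝ) else 0) * (if 0 < w ⬝ᵥ v then (1 : ℝ) else 0)
              * (w i * w j) ∂(stdGaussian k)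
      = ((π - θ) / (2 * π)) * (1 : Matrix (Fin k) (Fin k) ℝ) i j
        + (sin θ / (2 * π)) * Mmat (cos θ) (sin θ) u e i j := by
  obtain ⟨b, a, c, hac, rfl, rfl⟩ := exists_basis2 u e huu hee hue
  have hF : Measurable fun w : Fin k → ℝ => (if 0 < w ⬝ᵥ (b a).ofLp then (1 : ℝ) else 0) *
      (if 0 < w ⬝ᵥ v then (1 : ℝ) else 0) * (w i * w j) :=
    ((measurable_ind _).mul (measurable_ind _)).mul (by fun_prop)
  rw [rot_integral b _ hF]
  have e1 : ∀ s : Fin k → ℝ,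
      (if 0 < rotT b s ⬝ᵥ (b a).ofLp then (1 : ℝ) else 0) *
        (if 0 < rotT b s ⬝ᵥ v then (1 : ℝ) else 0) * (rotT b s i * rotT b s j) =
      ∑ p, ∑ q, (b p i * b q j) * (coneI θ (s a) (s c) * (s p * s q)) := by
    intro s
    rw [hv, dotProduct_add, dotProduct_smul, dotProduct_smul, rotT_dot, rotT_dot]
    simp only [smul_eq_mul]
    rw [← coneI, rotT, rotT, Finset.sum_mul_sum, Finset.mul_sum]
    refine Finset.sum_congr rfl fun p _ => ?_
    rw [Finset.mul_sum]
    exact Finset.sum_congr rfl fun q _ => by ring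
  simp only [e1]
  rw [integral_finsetSum _ (fun p _ => integrable_finsetSum _ fun q _ =>
    (integrable_cone θ a c p q).const_mul _)]
  have e2 : ∀ p, ∫ s, ∑ q, (b p i * b q j) * (coneI θ (s a) (s c) * (s p * s q)) ∂(stdGaussian k)
      = ∑ q, (b p i * b q j) * ((π - θ) / (2 * π) * (if p = q then 1 else 0)
          + sin θ / (2 * π) * mcoef θ a c p q) := by
    intro p
    rw [integral_finsetSum _ (fun q _ => (integrable_cone θ a c p q).const_mul _)]
    refine Finset.sum_congr rfl fun q _ => ?_
    rw [integral_const_mul, cone_coord θ h0 h1 a c p q hac]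
  simp only [e2]
  have key : ∀ f g : Fin k, ∑ p, ∑ q, (b p i * b q j) *
      ((if p = f then (1:ℝ) else 0) * (if q = g then (1:ℝ) else 0)) = b f i * b g j := by
    intro f g
    simp
  calc _ = (π - θ) / (2 * π) * (∑ p, ∑ q, (b p i * b q j) * (if p = q then 1 else 0))
        + sin θ / (2 * π) * (cos θ * (
            (∑ p, ∑ q, (b p i * b q j) *
              ((if p = a then (1:ℝ) else 0) * (if q = a then (1:ℝ) else 0)))
            - (∑ p, ∑ q, (b p i * b q j) *
              ((if p = c then (1:ℝ) else 0) * (if q = c then (1:ℝ) else 0))))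
          + sin θ * (
            (∑ p, ∑ q, (b p i * b q j) *
              ((if p = a then (1:ℝ) else 0) * (if q = c then (1:ℝ) else 0)))
            + (∑ p, ∑ q, (b p i * b q j) *
              ((if p = c then (1:ℝ) else 0) * (if q = a then (1:ℝ) else 0))))) := by
        simp only [Finset.mul_sum, ← Finset.sum_add_distrib, ← Finset.sum_sub_distrib]
        refine Finset.sum_congr rfl fun p _ => Finset.sum_congr rfl fun q _ => ?_
        rw [mcoef]; ring
    _ = _ := by
        rw [key, key, key, key, ← basis_complete b i j]
        simp [Mmat]

lemma integral_coord {k : ℕ} (i j : Fin k) :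
    ∫ s, s i * s j ∂(stdGaussian k) = (1 : Matrix (Fin k) (Fin k) ℝ) i j := by
  by_cases h : i = j
  · subst h; rw [integral_sq_coord]; simp
  · rw [Matrix.one_apply_ne h]
    have hm : Measurable fun s : Fin k → ℝ => s i * s j := by fun_prop
    have hh := integral_map (μ := stdGaussian k) (flip_preserving i).measurable.aemeasurable
      hm.aestronglyMeasurable
    rw [(flip_preserving i).map_eq] at hh
    simp only [Ne.symm h, if_true, if_false, neg_mul, integral_neg] at hh
    linarith

lemma neg_preserving (k : ℕ) :
    MeasurePreserving (fun (s : Fin k → ℝ) => -s) (stdGaussian k) (stdGaussian k) :=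
  measurePreserving_pi (fun _ : Fin k => gaussianReal 0 1) (fun _ => gaussianReal 0 1)
    (f := fun _ x => -x) (fun _ => ⟨measurable_neg, by
        simpa using gaussianReal_map_neg (μ := 0) (v := 1)⟩)

lemma ae_dot_ne {k : ℕ} (u : Fin k → ℝ) (huu : u ⬝ᵥ u = 1) :
    ∀ᵐ w ∂(stdGaussian k), w ⬝ᵥ u ≠ 0 := by
  obtain ⟨b, a, rfl⟩ := exists_basis1 u huu
  have hs : Measurable fun w : Fin k → ℝ => w ⬝ᵥ (b a).ofLp := by
    unfold dotProduct; fun_prop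
  have hset : MeasurableSet {w : Fin k → ℝ | w ⬝ᵥ (b a).ofLp ≠ 0} :=
    hs (measurableSet_singleton (0:ℝ)).compl
  rw [← map_rotT b, ae_map_iff (measurable_rotT b).aemeasurable hset]
  simp only [rotT_dot]
  have h2 : ∀ᵐ x ∂(gaussianReal 0 1), x ≠ (0:ℝ) := by
    have : NullSingletonClass (gaussianReal 0 1) := nullSingletonClass_gaussianReal one_ne_zero
    exact Measure.ae_ne _ _
  rw [← map_coord a] at h2
  exact ae_of_ae_map (measurable_pi_apply a).aemeasurable h2

lemma half_integral {k : ℕ} (u : Fin k → ℝ) (huu : u ⬝ᵥ u = 1) (i j : Fin k) :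
    ∫ w : Fin k → ℝ, (if 0 < w ⬝ᵥ u then (1 : ℝ) else 0) * (w i * w j) ∂(stdGaussian k)
      = 1 / 2 * (1 : Matrix (Fin k) (Fin k) ℝ) i j := by
  have hb : ∀ u : Fin k → ℝ, Integrable (fun w : Fin k → ℝ =>
      (if 0 < w ⬝ᵥ u then (1 : ℝ) else 0) * (w i * w j)) (stdGaussian k) := fun u =>
    (integrable_coord i j).bdd_mul (c := 1) (measurable_ind u).aestronglyMeasurable
      (Filter.Eventually.of_forall fun w => by split_ifs <;> simp)
  have hm : Measurable fun w : Fin k → ℝ =>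
      (if 0 < w ⬝ᵥ u then (1 : ℝ) else 0) * (w i * w j) := (measurable_ind u).mul (by fun_prop)
  have hh := integral_map (μ := stdGaussian k) (neg_preserving k).measurable.aemeasurable
    hm.aestronglyMeasurable
  rw [(neg_preserving k).map_eq] at hh
  have h3 : (∫ w : Fin k → ℝ, (if 0 < w ⬝ᵥ u then (1 : ℝ) else 0) * (w i * w j) ∂(stdGaussian k))
      + (∫ w : Fin k → ℝ, (if 0 < w ⬝ᵥ (-u) then (1 : ℝ) else 0) * (w i * w j) ∂(stdGaussian k))
      = (1 : Matrix (Fin k) (Fin k) ℝ) i j := by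
    rw [← integral_add (hb u) (hb (-u)), ← integral_coord i j]
    refine integral_congr_ae ?_
    filter_upwards [ae_dot_ne u huu] with w hw
    rw [dotProduct_neg]
    rcases lt_or_gt_of_ne hw with h | h
    · simp [h, not_lt.2 h.le]
    · simp [h, not_lt.2 h.le]
  have h4 : ∀ w : Fin k → ℝ, (-w) ⬝ᵥ u = w ⬝ᵥ (-u) := by intro w; simp
  simp only [h4, Pi.neg_apply, neg_mul_neg] at hh
  rw [← hh] at h3
  linarith

lemma unit_case {k : ℕ} (u v : Fin k → ℝ) (hu : u ⬝ᵥ u = 1) (hv : v ⬝ᵥ v = 1) :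
    ∃ M : Matrix (Fin k) (Fin k) ℝ,
      Mᵀ = M ∧ M.mulVec u = v ∧ M.mulVec v = u ∧
      (∀ z : Fin k → ℝ, z ⬝ᵥ u = 0 → z ⬝ᵥ v = 0 → M.mulVec z = 0) ∧
      (∀ i j : Fin k,
        ∫ w : Fin k → ℝ,
            (if 0 < w ⬝ᵥ u then (1 : ℝ) else 0) * (if 0 < w ⬝ᵥ v then (1 : ℝ) else 0)
              * (w i * w j) ∂(stdGaussian k)
          = ((π - Real.arccos (u ⬝ᵥ v)) / (2 * π)) * (1 : Matrix (Fin k) (Fin k) ℝ) i j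
            + (Real.sin (Real.arccos (u ⬝ᵥ v)) / (2 * π)) * M i j) := by
  have hvu : v ⬝ᵥ u = u ⬝ᵥ v := dotProduct_comm _ _
  have hd : (u - v) ⬝ᵥ (u - v) = 2 - 2 * (u ⬝ᵥ v) := by
    simp only [sub_dotProduct, dotProduct_sub, hu, hv, hvu]; ring
  have hs : (u + v) ⬝ᵥ (u + v) = 2 + 2 * (u ⬝ᵥ v) := by
    simp only [add_dotProduct, dotProduct_add, hu, hv, hvu]; ring
  have hd0 : 0 ≤ (u - v) ⬝ᵥ (u - v) := Finset.sum_nonneg fun i _ => mul_self_nonneg _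
  have hs0 : 0 ≤ (u + v) ⬝ᵥ (u + v) := Finset.sum_nonneg fun i _ => mul_self_nonneg _
  by_cases hc1 : u ⬝ᵥ v = 1
  · have : u - v = 0 := by
      rw [← dotProduct_self_eq_zero, hd, hc1]; norm_num
    obtain rfl : u = v := sub_eq_zero.1 this
    have hM := Mmat_mulVec 1 0 u 0
    refine ⟨Mmat 1 0 u 0, ?_, ?_, ?_, ?_, ?_⟩
    · ext i j; simp [Mmat, mul_comm]
    · rw [hM]; simp [hu]
    · rw [hM]; simp [hu]
    · intro z hz _; rw [hM, dotProduct_comm u z, hz]; simp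
    · intro i j
      have e : ∀ w : Fin k → ℝ, (if 0 < w ⬝ᵥ u then (1 : ℝ) else 0) *
        (if 0 < w ⬝ᵥ u then (1 : ℝ) else 0) = if 0 < w ⬝ᵥ u then (1 : ℝ) else 0 := by
        intro w; split_ifs <;> simp
      simp only [e]
      rw [half_integral u hu, hu, Real.arccos_one]
      simp; left; field_simp
  by_cases hc2 : u ⬝ᵥ v = -1
  · have : u + v = 0 := by
      rw [← dotProduct_self_eq_zero, hs, hc2]; norm_num
    obtain rfl : v = -u := (neg_eq_of_add_eq_zero_right this).symm
    have hM := Mmat_mulVec (-1) 0 u 0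
    refine ⟨Mmat (-1) 0 u 0, ?_, ?_, ?_, ?_, ?_⟩
    · ext i j; simp [Mmat, mul_comm]
    · rw [hM]; simp [hu]
    · rw [hM]; simp [hu]
    · intro z hz _; rw [hM, dotProduct_comm u z, hz]; simp
    · intro i j
      have e : ∀ w : Fin k → ℝ, (if 0 < w ⬝ᵥ u then (1 : ℝ) else 0) *
        (if 0 < w ⬝ᵥ (-u) then (1 : ℝ) else 0) = 0 := by
        intro w
        rw [dotProduct_neg]
        split_ifs <;> first | simp; done | (exfalso; linarith)
      simp only [e]
      rw [hc2, Real.arccos_neg_one]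
      simp
  have l1 : u ⬝ᵥ v < 1 := lt_of_le_of_ne (by linarith) hc1
  have l2 : -1 < u ⬝ᵥ v := lt_of_le_of_ne (by linarith) (Ne.symm hc2)
  have hcos : cos (arccos (u ⬝ᵥ v)) = u ⬝ᵥ v := Real.cos_arccos l2.le l1.le
  have t0 : 0 < arccos (u ⬝ᵥ v) := Real.arccos_pos.2 l1
  have t1 : arccos (u ⬝ᵥ v) < π := by
    refine lt_of_le_of_ne (Real.arccos_le_pi _) fun h => ?_
    rw [h, Real.cos_pi] at hcos; linarith
  have hsin := Real.sin_pos_of_pos_of_lt_pi t0 t1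
  have hsc := Real.sin_sq_add_cos_sq (arccos (u ⬝ᵥ v))
  generalize arccos (u ⬝ᵥ v) = θ at *
  obtain ⟨e, he⟩ : ∃ e : Fin k → ℝ, e = (sin θ)⁻¹ • (v - cos θ • u) := ⟨_, rfl⟩
  have hve : v = cos θ • u + sin θ • e := by
    rw [he, smul_smul, mul_inv_cancel₀ hsin.ne', one_smul]; abel
  have hue : u ⬝ᵥ e = 0 := by
    rw [he, dotProduct_smul, dotProduct_sub, dotProduct_smul, hu, hcos]; simp
  have heu : e ⬝ᵥ u = 0 := by rw [dotProduct_comm, hue]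
  have hee : e ⬝ᵥ e = 1 := by
    have h5 := hv
    rw [hve] at h5
    simp only [add_dotProduct, dotProduct_add, smul_dotProduct, dotProduct_smul, hu, hue, heu,
      smul_eq_mul] at h5
    have : sin θ ^ 2 * (e ⬝ᵥ e) = sin θ ^ 2 * 1 := by linarith
    exact mul_left_cancel₀ (by positivity) this
  have hM := Mmat_mulVec (cos θ) (sin θ) u e
  refine ⟨Mmat (cos θ) (sin θ) u e, ?_, ?_, ?_, ?_, ?_⟩
  · ext i j; simp only [Mmat, Matrix.transpose_apply, Matrix.of_apply]; ring
  · rw [hM, hu, heu, hve]; simp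
  · have h6 : e ⬝ᵥ v = sin θ := by
      rw [hve, dotProduct_add, dotProduct_smul, dotProduct_smul, heu, hee]; simp
    rw [hM, ← hcos, h6]
    have h7 : cos θ * cos θ + sin θ * sin θ = 1 := by linarith
    rw [h7, mul_comm (sin θ) (cos θ)]; simp
  · intro z hz hz2
    have h8 : e ⬝ᵥ z = 0 := by
      rw [dotProduct_comm, he, dotProduct_smul, dotProduct_sub, dotProduct_smul, hz, hz2]; simp
    rw [hM, dotProduct_comm u z, hz, h8]; simp
  · intro i j
    exact generic_integral θ t0 t1 u e v hu hee hue hve i j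

theorem gaussian_relu_covariance (k : ℕ) (x y : Fin k → ℝ) (hx : x ≠ 0) (hy : y ≠ 0) :
    ∃ M : Matrix (Fin k) (Fin k) ℝ,
      Mᵀ = M ∧
      M.mulVec ((n2 x)⁻¹ • x) = (n2 y)⁻¹ • y ∧
      M.mulVec ((n2 y)⁻¹ • y) = (n2 x)⁻¹ • x ∧
      (∀ z : Fin k → ℝ, z ⬝ᵥ x = 0 → z ⬝ᵥ y = 0 → M.mulVec z = 0) ∧
      (∀ i j : Fin k,
        ∫ w : Fin k → ℝ,
            (if 0 < w ⬝ᵥ x then (1 : ℝ) else 0) * (if 0 < w ⬝ᵥ y then (1 : ℝ) else 0)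
              * (w i * w j) ∂(stdGaussian k)
          = ((π - Real.arccos ((x ⬝ᵥ y) / (n2 x * n2 y))) / (2 * π))
              * (1 : Matrix (Fin k) (Fin k) ℝ) i j
            + (Real.sin (Real.arccos ((x ⬝ᵥ y) / (n2 x * n2 y))) / (2 * π)) * M i j) := by
  have pos : ∀ x : Fin k → ℝ, x ≠ 0 → 0 < n2 x ∧ ((n2 x)⁻¹ • x) ⬝ᵥ ((n2 x)⁻¹ • x) = 1 := by
    intro x hx
    have h0 : 0 ≤ x ⬝ᵥ x := Finset.sum_nonneg fun i _ => mul_self_nonneg _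
    have h1 : 0 < x ⬝ᵥ x := lt_of_le_of_ne h0 (fun h => hx (dotProduct_self_eq_zero.1 h.symm))
    have h2 : 0 < n2 x := Real.sqrt_pos.2 h1
    have h3 : n2 x * n2 x = x ⬝ᵥ x := Real.mul_self_sqrt h0
    refine ⟨h2, ?_⟩
    rw [smul_dotProduct, dotProduct_smul, ← h3]
    simp only [smul_eq_mul]
    field_simp
  obtain ⟨px, ux⟩ := pos x hx
  obtain ⟨py, uy⟩ := pos y hy
  obtain ⟨M, h1, h2, h3, h4, h5⟩ := unit_case _ _ ux uy
  have hd : ((n2 x)⁻¹ • x) ⬝ᵥ ((n2 y)⁻¹ • y) = (x ⬝ᵥ y) / (n2 x * n2 y) := by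
    rw [smul_dotProduct, dotProduct_smul]
    simp only [smul_eq_mul]
    field_simp
  have hw : ∀ (x w : Fin k → ℝ), 0 < n2 x → (0 < w ⬝ᵥ ((n2 x)⁻¹ • x) ↔ 0 < w ⬝ᵥ x) := by
    intro x w h
    rw [dotProduct_smul, smul_eq_mul, mul_pos_iff_of_pos_left (inv_pos.2 h)]
  refine ⟨M, h1, h2, h3, fun z hz1 hz2 => h4 z ?_ ?_, fun i j => ?_⟩
  · rw [dotProduct_smul, hz1, smul_zero]
  · rw [dotProduct_smul, hz2, smul_zero]
  · have := h5 i j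
    simp only [hw x _ px, hw y _ py, hd] at this
    exact this
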